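/- Let r := min{rank A, rank B}. The maximum of γ_{C_qm} over C_max is achieved by the following correlations: (i) if r = 3, by C = A Q Bᵀ for every Q ∈ SO(3), and the maximal value is 3; moreover for Q ∈ SO⁻(3) one has γ_{C_qm}(A Q Bᵀ) = 1; (ii) if r ≤ 2 and both rank A ≥ 2 and rank B ≥ 2, by C = A Q Bᵀ for every Q ∈ O(3), with maximal value 1; (iii) if rank A = 1 or rank B = 1, by C = A Q Bᵀ for every Q ∈ O(3) with col Aᵀ ∩ Q(col Bᵀ) ≠ {0}, with maximal value 1. -/

import Mathlib

open Matrix Kronecker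
open scoped ENNReal ComplexOrder

namespace BellCorr

/-- The three Pauli matrices. -/
noncomputable def pauli (k : Fin 3) : Matrix (Fin 2) (Fin 2) ℂ :=
  if k = 0 then !![0, 1; 1, 0]
  else if k = 1 then !![0, -Complex.I; Complex.I, 0]
  else !![1, 0; 0, -1]

/-- The observable `Â_i = ∑ k A i k • σ_k` associated with row `i` of `A`. -/
noncomputable def obs {m : ℕ} (A : Matrix (Fin m) (Fin 3) ℝ) (i : Fin m) :
    Matrix (Fin 2) (Fin 2) ℂ :=
  ∑ k : Fin 3, (A i k : ℂ) • pauli k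

/-- The correlation map `Φ_AB`, sending a 4×4 complex matrix to the real m×m matrix
with entries `Tr[ρ (Â_i ⊗ B̂_j)]`. -/
noncomputable def corr {m : ℕ} (A B : Matrix (Fin m) (Fin 3) ℝ)
    (ρ : Matrix (Fin 2 × Fin 2) (Fin 2 × Fin 2) ℂ) : Matrix (Fin m) (Fin m) ℝ :=
  Matrix.of fun i j => ((ρ * (obs A i ⊗ₖ obs B j)).trace).re

/-- Separable states: convex hull of products of 2×2 PSD trace-one matrices. -/
noncomputable def Ssep : Set (Matrix (Fin 2 × Fin 2) (Fin 2 × Fin 2) ℂ) :=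
  convexHull ℝ {ρ | ∃ ρA ρB : Matrix (Fin 2) (Fin 2) ℂ,
    ρA.PosSemidef ∧ ρA.trace = 1 ∧ ρB.PosSemidef ∧ ρB.trace = 1 ∧ ρ = ρA ⊗ₖ ρB}

/-- Quantum states: 4×4 PSD matrices of trace one. -/
def Sqm : Set (Matrix (Fin 2 × Fin 2) (Fin 2 × Fin 2) ℂ) :=
  {ρ | ρ.PosSemidef ∧ ρ.trace = 1}

/-- Maximal-tensor-product states: self-adjoint trace-one matrices pairing
nonnegatively with every product of PSD matrices. -/
def Smax : Set (Matrix (Fin 2 × Fin 2) (Fin 2 × Fin 2) ℂ) :=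
  {ρ | ρ.IsHermitian ∧ ρ.trace = 1 ∧
    ∀ P Q : Matrix (Fin 2) (Fin 2) ℂ, P.PosSemidef → Q.PosSemidef →
      0 ≤ ((ρ * (P ⊗ₖ Q)).trace).re}

noncomputable def Csep {m : ℕ} (A B : Matrix (Fin m) (Fin 3) ℝ) :
    Set (Matrix (Fin m) (Fin m) ℝ) := corr A B '' Ssep

noncomputable def Cqm {m : ℕ} (A B : Matrix (Fin m) (Fin 3) ℝ) :
    Set (Matrix (Fin m) (Fin m) ℝ) := corr A B '' Sqm

noncomputable def Cmax {m : ℕ} (A B : Matrix (Fin m) (Fin 3) ℝ) :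
    Set (Matrix (Fin m) (Fin m) ℝ) := corr A B '' Smax

/-- Support function `φ_K(Z) = sup_{C ∈ K} Tr[Zᵀ C]`. -/
noncomputable def suppFn {m : ℕ} (K : Set (Matrix (Fin m) (Fin m) ℝ))
    (Z : Matrix (Fin m) (Fin m) ℝ) : ℝ :=
  sSup ((fun C => (Zᵀ * C).trace) '' K)

/-- Gauge function `γ_K(C) = inf {t > 0 : C/t ∈ K}`, with value `+∞` if no such `t` exists. -/
noncomputable def gaugeFn {m : ℕ} (K : Set (Matrix (Fin m) (Fin m) ℝ))
    (C : Matrix (Fin m) (Fin m) ℝ) : ℝ≥0∞ :=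
  ⨅ (t : ℝ) (_ : 0 < t ∧ t⁻¹ • C ∈ K), ENNReal.ofReal t

/-- `XᵀX` is Hermitian for a real matrix `X`. -/
lemma isHermitian_tr_mul_self (X : Matrix (Fin 3) (Fin 3) ℝ) : (Xᵀ * X).IsHermitian := by
  simpa [Matrix.conjTranspose_eq_transpose_of_trivial] using
    Matrix.isHermitian_conjTranspose_mul_self X

/-- The singular values of a real 3×3 matrix, in decreasing order:
`sval X 0 ≥ sval X 1 ≥ sval X 2 ≥ 0` are the square roots of the eigenvalues of `XᵀX`. -/
noncomputable def sval (X : Matrix (Fin 3) (Fin 3) ℝ) (i : Fin 3) : ℝ :=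
  Real.sqrt ((isHermitian_tr_mul_self X).eigenvalues
    (Tuple.sort (isHermitian_tr_mul_self X).eigenvalues i.rev))

/-- Column space of a real matrix. -/
noncomputable def colSpace {m n : ℕ} (X : Matrix (Fin m) (Fin n) ℝ) :
    Submodule ℝ (Fin m → ℝ) := LinearMap.range X.mulVecLin

/-- `Y` is the Moore–Penrose pseudoinverse of `X`. -/
def IsMP {m n : ℕ} (X : Matrix (Fin m) (Fin n) ℝ) (Y : Matrix (Fin n) (Fin m) ℝ) : Prop :=
  X * Y * X = X ∧ Y * X * Y = Y ∧ (X * Y)ᵀ = X * Y ∧ (Y * X)ᵀ = Y * X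

/-- The Bloch-type matrix `∑ k, v k • σ_k`. -/
noncomputable def pauliVec (v : Fin 3 → ℝ) : Matrix (Fin 2) (Fin 2) ℂ :=
  ∑ k, (v k : ℂ) • pauli k

lemma pauliVec_eq (v : Fin 3 → ℝ) :
    pauliVec v = !![(v 2 : ℂ), v 0 - v 1 * Complex.I; v 0 + v 1 * Complex.I, -v 2] := by
  ext i j
  fin_cases i <;> fin_cases j <;>
    simp [pauliVec, Fin.sum_univ_three, pauli, sub_eq_add_neg]

lemma pauliVec_isHermitian (v : Fin 3 → ℝ) : (pauliVec v).IsHermitian := by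
  rw [pauliVec_eq]
  ext i j
  fin_cases i <;> fin_cases j <;> simp [sub_eq_add_neg]

lemma pauliVec_mul (v w : Fin 3 → ℝ) :
    pauliVec v * pauliVec w =
      ((v ⬝ᵥ w : ℝ) : ℂ) • 1 + Complex.I • pauliVec (crossProduct v w) := by
  simp only [pauliVec_eq]
  ext i j
  fin_cases i <;> fin_cases j <;>
    simp [cross_apply, dotProduct, Fin.sum_univ_three] <;>
    ring_nf <;> simp <;> ring

lemma trace_pauliVec (v : Fin 3 → ℝ) : (pauliVec v).trace = 0 := by
  simp [pauliVec_eq, Matrix.trace_fin_two]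

lemma pauliVec_mul_self (v : Fin 3 → ℝ) :
    pauliVec v * pauliVec v = ((v ⬝ᵥ v : ℝ) : ℂ) • 1 := by
  rw [pauliVec_mul, cross_self]
  simp [pauliVec]

lemma kronecker_isHermitian (v w : Fin 3 → ℝ) :
    (pauliVec v ⊗ₖ pauliVec w).IsHermitian := by
  rw [Matrix.IsHermitian, conjTranspose_kronecker, (pauliVec_isHermitian v).eq,
    (pauliVec_isHermitian w).eq]

lemma kronecker_mul_self (v w : Fin 3 → ℝ) :
    (pauliVec v ⊗ₖ pauliVec w) * (pauliVec v ⊗ₖ pauliVec w) =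
      (((v ⬝ᵥ v) * (w ⬝ᵥ w) : ℝ) : ℂ) • 1 := by
  rw [← mul_kronecker_mul, pauliVec_mul_self, pauliVec_mul_self, smul_kronecker, kronecker_smul,
    one_kronecker_one, smul_smul]
  push_cast
  rfl

lemma posSemidef_mul_self {n : Type*} [Fintype n] {H : Matrix n n ℂ} (hH : H.IsHermitian) :
    (H * H).PosSemidef := by
  have := posSemidef_conjTranspose_mul_self H
  rwa [hH.eq] at this

lemma posSemidef_ofReal_smul {n : Type*} {M : Matrix n n ℂ} (hM : M.PosSemidef) {c : ℝ}
    (hc : 0 ≤ c) : ((c : ℂ) • M).PosSemidef :=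
  hM.smul (by exact_mod_cast hc)

/-- `1 + H` is positive semidefinite when `H` is Hermitian with `H² = c ≤ 1`. -/
lemma posSemidef_one_add {n : Type*} [Fintype n] [DecidableEq n] {H : Matrix n n ℂ}
    (hH : H.IsHermitian) {c : ℝ} (hc : c ≤ 1) (hsq : H * H = (c : ℂ) • 1) :
    (1 + H).PosSemidef := by
  have h1 := posSemidef_mul_self (Matrix.isHermitian_one.add hH)
  have h2 : (((1 - c : ℝ) : ℂ) • (1 : Matrix n n ℂ)).PosSemidef :=
    posSemidef_ofReal_smul .one (by linarith)
  have h3 := posSemidef_ofReal_smul (h1.add h2) (c := 1 / 2) (by norm_num)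
  convert! h3 using 1
  rw [show (1 + H) * (1 + H) = 1 + (2 : ℂ) • H + H * H by rw [two_smul]; noncomm_ring, hsq]
  push_cast
  module

lemma posSemidef_one_add_mul {n : Type*} [Fintype n] [DecidableEq n] {X Y : Matrix n n ℂ}
    (hX : X.IsHermitian) (hY : Y.IsHermitian) {c d : ℝ} (hc : c ≤ 1) (hd : d ≤ 1)
    (hXX : X * X = (c : ℂ) • 1) (hYY : Y * Y = (d : ℂ) • 1) (hXY : X * Y = Y * X) :
    (1 + X + Y + X * Y).PosSemidef := by
  have hcomm : Commute (1 + X) (1 + Y) :=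
    ((Commute.one_left _).add_left ((Commute.one_right _).add_right hXY))
  have hX1 := Matrix.isHermitian_one.add hX
  have hY1 := Matrix.isHermitian_one.add hY
  have hH : ((1 + X) * (1 + Y)).IsHermitian := by
    rw [Matrix.IsHermitian, conjTranspose_mul, hX1.eq, hY1.eq, hcomm.eq]
  have h1 := posSemidef_mul_self hH
  have h2 := posSemidef_ofReal_smul (posSemidef_mul_self hY1) (c := 1 - c) (by linarith)
  have h3 := posSemidef_ofReal_smul (posSemidef_mul_self hX1) (c := 1 - d) (by linarith)
  have h4 : ((((1 - c) * (1 - d) : ℝ) : ℂ) • (1 : Matrix n n ℂ)).PosSemidef :=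
    posSemidef_ofReal_smul .one (mul_nonneg (by linarith) (by linarith))
  have h5 := posSemidef_ofReal_smul (((h1.add h2).add h3).add h4) (c := 1 / 4) (by norm_num)
  convert! h5 using 1
  have eX : (1 + X) * (1 + X) = ((1 + c : ℝ) : ℂ) • 1 + (2 : ℂ) • X := by
    rw [show (1 + X) * (1 + X) = 1 + (2 : ℂ) • X + X * X by rw [two_smul]; noncomm_ring, hXX]
    push_cast
    module
  have eY : (1 + Y) * (1 + Y) = ((1 + d : ℝ) : ℂ) • 1 + (2 : ℂ) • Y := by
    rw [show (1 + Y) * (1 + Y) = 1 + (2 : ℂ) • Y + Y * Y by rw [two_smul]; noncomm_ring, hYY]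
    push_cast
    module
  have eXY : (1 + X) * (1 + Y) * ((1 + X) * (1 + Y)) =
      (((1 + c : ℝ) : ℂ) • 1 + (2 : ℂ) • X) * (((1 + d : ℝ) : ℂ) • 1 + (2 : ℂ) • Y) := by
    rw [← eX, ← eY, hcomm.mul_mul_mul_comm]
  rw [eXY, eX, eY]
  simp only [add_mul, mul_add, smul_mul_assoc, mul_smul_comm, one_mul, mul_one]
  push_cast
  module

/-- The operator `∑ k l, T k l • σ_k ⊗ σ_l`. -/
noncomputable def pauliTensor (T : Matrix (Fin 3) (Fin 3) ℝ) :
    Matrix (Fin 2 × Fin 2) (Fin 2 × Fin 2) ℂ :=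
  ∑ k, ∑ l, (T k l : ℂ) • (pauli k ⊗ₖ pauli l)

lemma pauliTensor_add (S T : Matrix (Fin 3) (Fin 3) ℝ) :
    pauliTensor (S + T) = pauliTensor S + pauliTensor T := by
  simp [pauliTensor, add_smul, Finset.sum_add_distrib]

lemma pauliTensor_smul (c : ℝ) (T : Matrix (Fin 3) (Fin 3) ℝ) :
    pauliTensor (c • T) = (c : ℂ) • pauliTensor T := by
  simp only [pauliTensor, Matrix.smul_apply, smul_eq_mul, Complex.ofReal_mul, Finset.smul_sum,
    smul_smul]

lemma pauliTensor_neg (T : Matrix (Fin 3) (Fin 3) ℝ) :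
    pauliTensor (-T) = -pauliTensor T := by
  simp [pauliTensor]

lemma pauliTensor_vecMulVec (v w : Fin 3 → ℝ) :
    pauliTensor (vecMulVec v w) = pauliVec v ⊗ₖ pauliVec w := by
  simp only [pauliTensor, pauliVec, vecMulVec_apply, Fin.sum_univ_three, add_kronecker,
    kronecker_add, smul_kronecker, kronecker_smul]
  push_cast
  module

/-- With `X` and `Y` the product operators of the pairs `(e₀, t₀)` and `(e₁, t₁)`, the matrix below
is the product of the commuting positive semidefinite matrices `1 + X` and `1 + Y`. -/
lemma posSemidef_one_add_pauliTensor {e₀ e₁ t₀ t₁ : Fin 3 → ℝ}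
    (he : e₀ ⬝ᵥ e₁ = 0) (ht : t₀ ⬝ᵥ t₁ = 0)
    (h₀ : (e₀ ⬝ᵥ e₀) * (t₀ ⬝ᵥ t₀) ≤ 1) (h₁ : (e₁ ⬝ᵥ e₁) * (t₁ ⬝ᵥ t₁) ≤ 1) :
    (1 + pauliTensor (vecMulVec e₀ t₀ + vecMulVec e₁ t₁ -
      vecMulVec (crossProduct e₀ e₁) (crossProduct t₀ t₁))).PosSemidef := by
  have hXY : (pauliVec e₀ ⊗ₖ pauliVec t₀) * (pauliVec e₁ ⊗ₖ pauliVec t₁) =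
      -(pauliVec (crossProduct e₀ e₁) ⊗ₖ pauliVec (crossProduct t₀ t₁)) := by
    rw [← mul_kronecker_mul, pauliVec_mul, pauliVec_mul, he, ht]
    simp [smul_kronecker, kronecker_smul, smul_smul]
  have hneg : ∀ v, pauliVec (-v) = -pauliVec v := fun v => by simp [pauliVec]
  have hkk : ∀ a b : Matrix (Fin 2) (Fin 2) ℂ, (-a) ⊗ₖ (-b) = a ⊗ₖ b := fun a b => by
    ext i j
    simp [kroneckerMap_apply]
  have hYX : (pauliVec e₁ ⊗ₖ pauliVec t₁) * (pauliVec e₀ ⊗ₖ pauliVec t₀) =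
      -(pauliVec (crossProduct e₀ e₁) ⊗ₖ pauliVec (crossProduct t₀ t₁)) := by
    rw [← mul_kronecker_mul, pauliVec_mul, pauliVec_mul, dotProduct_comm e₁, dotProduct_comm t₁,
      he, ht, ← cross_anticomm e₀, ← cross_anticomm t₀, hneg, hneg]
    simp [smul_kronecker, kronecker_smul, smul_smul, hkk]
  have := posSemidef_one_add_mul (kronecker_isHermitian e₀ t₀) (kronecker_isHermitian e₁ t₁)
    h₀ h₁ (kronecker_mul_self _ _) (kronecker_mul_self _ _) (hXY.trans hYX.symm)
  rw [hXY] at this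
  rw [sub_eq_add_neg, pauliTensor_add, pauliTensor_add, pauliTensor_neg,
    pauliTensor_vecMulVec, pauliTensor_vecMulVec, pauliTensor_vecMulVec]
  convert! this using 1
  abel

/-- The correlation tensor `Tr[ρ (σ_k ⊗ σ_l)]` of a matrix `ρ`. -/
noncomputable def corrTensor (ρ : Matrix (Fin 2 × Fin 2) (Fin 2 × Fin 2) ℂ) :
    Matrix (Fin 3) (Fin 3) ℝ :=
  Matrix.of fun k l => ((ρ * (pauli k ⊗ₖ pauli l)).trace).re

lemma re_trace_mul_pauliTensor (ρ : Matrix (Fin 2 × Fin 2) (Fin 2 × Fin 2) ℂ)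
    (T : Matrix (Fin 3) (Fin 3) ℝ) :
    ((ρ * pauliTensor T).trace).re = ∑ k, ∑ l, T k l * corrTensor ρ k l := by
  simp [pauliTensor, Matrix.mul_sum, Matrix.trace_sum, corrTensor]

lemma re_trace_mul_kronecker (ρ : Matrix (Fin 2 × Fin 2) (Fin 2 × Fin 2) ℂ) (v w : Fin 3 → ℝ) :
    ((ρ * (pauliVec v ⊗ₖ pauliVec w)).trace).re = v ⬝ᵥ corrTensor ρ *ᵥ w := by
  rw [← pauliTensor_vecMulVec, re_trace_mul_pauliTensor]
  simp only [dotProduct, mulVec, Finset.mul_sum, vecMulVec_apply]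
  exact Finset.sum_congr rfl fun k _ => Finset.sum_congr rfl fun l _ => by ring

lemma corr_eq {m : ℕ} (A B : Matrix (Fin m) (Fin 3) ℝ)
    (ρ : Matrix (Fin 2 × Fin 2) (Fin 2 × Fin 2) ℂ) :
    corr A B ρ = A * corrTensor ρ * Bᵀ := by
  ext i j
  have h := re_trace_mul_kronecker ρ (A i) (B j)
  rw [corr, Matrix.of_apply, show obs A i = pauliVec (A i) from rfl,
    show obs B j = pauliVec (B j) from rfl, h, Matrix.mul_assoc]
  rfl

/-- The matrix with maximally mixed marginals and correlation tensor `T`. -/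
noncomputable def bellState (T : Matrix (Fin 3) (Fin 3) ℝ) :
    Matrix (Fin 2 × Fin 2) (Fin 2 × Fin 2) ℂ :=
  ((1 / 4 : ℝ) : ℂ) • (1 + pauliTensor T)

lemma trace_pauli (k : Fin 3) : (pauli k).trace = 0 := by
  fin_cases k <;> simp [pauli, Matrix.trace_fin_two]

lemma trace_pauli_mul (k l : Fin 3) : (pauli k * pauli l).trace = if k = l then 2 else 0 := by
  fin_cases k <;> fin_cases l <;> simp [pauli, Matrix.trace_fin_two] <;> norm_num

lemma trace_pauliTensor (T : Matrix (Fin 3) (Fin 3) ℝ) : (pauliTensor T).trace = 0 := by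
  simp [pauliTensor, Matrix.trace_sum, trace_kronecker, trace_pauli]

lemma trace_bellState (T : Matrix (Fin 3) (Fin 3) ℝ) : (bellState T).trace = 1 := by
  simp [bellState, trace_pauliTensor]

lemma bellState_isHermitian (T : Matrix (Fin 3) (Fin 3) ℝ) : (bellState T).IsHermitian := by
  have hp : ∀ k, (pauli k)ᴴ = pauli k := fun k => by
    ext i j
    fin_cases k <;> fin_cases i <;> fin_cases j <;> simp [pauli]
  simp [Matrix.IsHermitian, bellState, pauliTensor, conjTranspose_sum, conjTranspose_kronecker, hp]

lemma corrTensor_bellState (T : Matrix (Fin 3) (Fin 3) ℝ) : corrTensor (bellState T) = T := by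
  ext k l
  have h : (bellState T * (pauli k ⊗ₖ pauli l)).trace = T k l := by
    simp only [bellState, pauliTensor, smul_mul_assoc, add_mul, one_mul, Finset.sum_mul,
      ← mul_kronecker_mul, trace_smul, trace_add, trace_sum, trace_kronecker, trace_pauli,
      trace_pauli_mul]
    simp
    ring
  simp [corrTensor, h]

lemma mem_Cqm {m : ℕ} (A B : Matrix (Fin m) (Fin 3) ℝ) {T : Matrix (Fin 3) (Fin 3) ℝ}
    (h : (1 + pauliTensor T).PosSemidef) : A * T * Bᵀ ∈ Cqm A B :=
  ⟨bellState T, ⟨posSemidef_ofReal_smul h (by norm_num), trace_bellState T⟩, by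
    rw [corr_eq, corrTensor_bellState]⟩

/-- `T` is a contraction, tested on pairs of vectors in the unit ball. -/
def IsContr (T : Matrix (Fin 3) (Fin 3) ℝ) : Prop :=
  ∀ v w : Fin 3 → ℝ, v ⬝ᵥ v ≤ 1 → w ⬝ᵥ w ≤ 1 → v ⬝ᵥ T *ᵥ w ≤ 1

lemma isContr_corrTensor {ρ : Matrix (Fin 2 × Fin 2) (Fin 2 × Fin 2) ℂ} (hρ : ρ ∈ Smax) :
    IsContr (corrTensor ρ) := by
  intro v w hv hw
  have hpsd : ∀ u : Fin 3 → ℝ, u ⬝ᵥ u ≤ 1 →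
      (1 + pauliVec u).PosSemidef ∧ (1 - pauliVec u).PosSemidef := fun u hu => by
    refine ⟨posSemidef_one_add (pauliVec_isHermitian u) hu (pauliVec_mul_self u), ?_⟩
    rw [sub_eq_add_neg]
    exact posSemidef_one_add (pauliVec_isHermitian u).neg hu
      (by rw [neg_mul_neg, pauliVec_mul_self u])
  have h1 := hρ.2.2 _ _ (hpsd v hv).1 (hpsd w hw).2
  have h2 := hρ.2.2 _ _ (hpsd v hv).2 (hpsd w hw).1
  have h3 : (1 + pauliVec v) ⊗ₖ (1 - pauliVec w) + (1 - pauliVec v) ⊗ₖ (1 + pauliVec w) =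
      (2 : ℂ) • 1 - (2 : ℂ) • (pauliVec v ⊗ₖ pauliVec w) := by
    rw [← one_kronecker_one]
    ext i j
    simp only [Matrix.add_apply, Matrix.sub_apply, Matrix.smul_apply, kroneckerMap_apply,
      smul_eq_mul]
    ring
  have h4 : 0 ≤ ((ρ * ((2 : ℂ) • 1 - (2 : ℂ) • (pauliVec v ⊗ₖ pauliVec w))).trace).re := by
    rw [← h3, mul_add, trace_add, Complex.add_re]
    exact add_nonneg h1 h2
  rw [mul_sub, trace_sub, mul_smul_comm, mul_smul_comm, trace_smul, trace_smul, mul_one, hρ.2.1,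
    Complex.sub_re, smul_eq_mul, smul_eq_mul] at h4
  rw [← re_trace_mul_kronecker]
  simp at h4
  linarith

lemma exists_pauliVec_of_posSemidef {P : Matrix (Fin 2) (Fin 2) ℂ} (hP : P.PosSemidef) :
    ∃ (p : ℝ) (v : Fin 3 → ℝ), 0 ≤ p ∧ v ⬝ᵥ v ≤ p ^ 2 ∧ P = (p : ℂ) • 1 + pauliVec v := by
  have h0 := hP.diag_nonneg (i := 0)
  have h1 := hP.diag_nonneg (i := 1)
  have hd := hP.det_nonneg
  have h10 : P 1 0 = star (P 0 1) := (hP.1.apply 1 0).symm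
  rw [det_fin_two, h10] at hd
  rw [Complex.le_def] at h0 h1 hd
  simp at h0 h1 hd
  refine ⟨((P 0 0).re + (P 1 1).re) / 2,
    ![(P 0 1).re, -(P 0 1).im, ((P 0 0).re - (P 1 1).re) / 2], by linarith, ?_, ?_⟩
  · simp [dotProduct, Fin.sum_univ_three]
    nlinarith [hd.1, h0.2, h1.2]
  · rw [pauliVec_eq]
    ext i j
    fin_cases i <;> fin_cases j <;> apply Complex.ext <;> simp [h10, ← h0.2, ← h1.2] <;> ring

lemma IsContr.le_mul {T : Matrix (Fin 3) (Fin 3) ℝ} (hT : IsContr T) {v w : Fin 3 → ℝ} {p q : ℝ}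
    (hp : 0 ≤ p) (hq : 0 ≤ q) (hv : v ⬝ᵥ v ≤ p ^ 2) (hw : w ⬝ᵥ w ≤ q ^ 2) :
    v ⬝ᵥ T *ᵥ w ≤ p * q := by
  have hz : ∀ u : Fin 3 → ℝ, u ⬝ᵥ u ≤ 0 ^ 2 → u = 0 := fun u hu =>
    dotProduct_self_eq_zero.1 (le_antisymm (by simpa using hu)
      (by simpa using dotProduct_star_self_nonneg u))
  rcases hp.eq_or_lt with rfl | hp'
  · simp [hz v hv]
  rcases hq.eq_or_lt with rfl | hq'
  · simp [hz w hw]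
  have hs : ∀ {u : Fin 3 → ℝ} {r : ℝ}, 0 < r → u ⬝ᵥ u ≤ r ^ 2 →
      (r⁻¹ • u) ⬝ᵥ (r⁻¹ • u) ≤ 1 := fun {u r} hr hu => by
    rw [smul_dotProduct, dotProduct_smul, smul_eq_mul, smul_eq_mul, ← mul_assoc, ← mul_inv,
      ← pow_two, inv_mul_le_one₀ (by positivity)]
    exact hu
  have h := hT _ _ (hs hp' hv) (hs hq' hw)
  rw [mulVec_smul, smul_dotProduct, dotProduct_smul, smul_eq_mul, smul_eq_mul, ← mul_assoc,
    ← mul_inv, inv_mul_le_one₀ (by positivity)] at h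
  exact h

lemma mem_Smax {T : Matrix (Fin 3) (Fin 3) ℝ} (hT : IsContr T) : bellState T ∈ Smax := by
  refine ⟨bellState_isHermitian T, trace_bellState T, fun P Q hP hQ => ?_⟩
  obtain ⟨p, v, hp, hv, rfl⟩ := exists_pauliVec_of_posSemidef hP
  obtain ⟨q, w, hq, hw, rfl⟩ := exists_pauliVec_of_posSemidef hQ
  have h1 := hT.le_mul (v := -v) hp hq (by simpa using hv) hw
  have h2 : ∀ X : Matrix (Fin 2) (Fin 2) ℂ,
      (pauliTensor T * (1 ⊗ₖ X)).trace = 0 ∧ (pauliTensor T * (X ⊗ₖ 1)).trace = 0 := by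
    intro X
    simp [pauliTensor, Finset.sum_mul, trace_sum, ← mul_kronecker_mul, trace_kronecker,
      trace_pauli]
  have h3 := re_trace_mul_kronecker (bellState T) v w
  rw [corrTensor_bellState] at h3
  have h4 : (bellState T * (((p : ℂ) • 1 + pauliVec v) ⊗ₖ ((q : ℂ) • 1 + pauliVec w))).trace =
      p * q + (bellState T * (pauliVec v ⊗ₖ pauliVec w)).trace := by
    have h5 : (bellState T * (1 ⊗ₖ pauliVec w)).trace = 0 := by
      rw [bellState, smul_mul_assoc, add_mul, trace_smul, trace_add, one_mul, trace_kronecker,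
        trace_pauliVec, (h2 _).1]
      simp
    have h6 : (bellState T * (pauliVec v ⊗ₖ 1)).trace = 0 := by
      rw [bellState, smul_mul_assoc, add_mul, trace_smul, trace_add, one_mul, trace_kronecker,
        trace_pauliVec, (h2 _).2]
      simp
    rw [add_kronecker, kronecker_add, kronecker_add, smul_kronecker, kronecker_smul,
      smul_kronecker, kronecker_smul, one_kronecker_one]
    simp only [mul_add, trace_add, mul_smul_comm, trace_smul, mul_one, h5, h6, trace_bellState]
    simp
  rw [h4, Complex.add_re, h3]
  simp at h1 ⊢
  linarith

lemma mem_Cmax {m : ℕ} (A B : Matrix (Fin m) (Fin 3) ℝ) {T : Matrix (Fin 3) (Fin 3) ℝ}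
    (h : IsContr T) : A * T * Bᵀ ∈ Cmax A B :=
  ⟨bellState T, mem_Smax h, by rw [corr_eq, corrTensor_bellState]⟩

lemma re_trace_mul_nonneg {n : Type*} [Fintype n] [DecidableEq n] {X Y : Matrix n n ℂ}
    (hX : X.PosSemidef) (hY : Y.PosSemidef) : 0 ≤ ((X * Y).trace).re := by
  open scoped MatrixOrder Matrix.Norms.L2Operator in
  obtain ⟨Z, rfl⟩ := CStarAlgebra.nonneg_iff_eq_star_mul_self.mp hY.nonneg
  have h := (hX.mul_mul_conjTranspose_same Z).trace_nonneg
  rw [Matrix.mul_assoc, trace_mul_comm] at h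
  rw [star_eq_conjTranspose, ← Matrix.mul_assoc, trace_mul_comm, ← Matrix.mul_assoc]
  rw [trace_mul_comm, ← Matrix.mul_assoc] at h
  exact (Complex.le_def.1 h).1

lemma Sqm_subset_Smax : Sqm ⊆ Smax := fun _ hρ =>
  ⟨hρ.1.1, hρ.2, fun _ _ hP hQ => re_trace_mul_nonneg hρ.1 (hP.kronecker hQ)⟩

lemma isContr_of_orthogonal {Q : Matrix (Fin 3) (Fin 3) ℝ} (hQ : Qᵀ * Q = 1) : IsContr Q := by
  intro v w hv hw
  have h1 : (Q *ᵥ w) ⬝ᵥ (Q *ᵥ w) = w ⬝ᵥ w := by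
    rw [dotProduct_mulVec, ← mulVec_transpose, mulVec_mulVec, hQ, one_mulVec]
  have h2 : 0 ≤ (v - Q *ᵥ w) ⬝ᵥ (v - Q *ᵥ w) := by
    simpa using dotProduct_star_self_nonneg (v - Q *ᵥ w)
  rw [sub_dotProduct, dotProduct_sub, dotProduct_sub, h1, dotProduct_comm (Q *ᵥ w) v] at h2
  linarith

/-- The last row of an orthogonal matrix of determinant `-1`. -/
lemma row_two_eq_of_det_eq_neg_one {Q : Matrix (Fin 3) (Fin 3) ℝ} (hQ : Qᵀ * Q = 1)
    (hdet : Q.det = -1) : Q 2 = -crossProduct (Q 0) (Q 1) := by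
  have h1 : Q.adjugate = -Qᵀ := by
    have h2 : Q * Qᵀ = 1 := mul_eq_one_comm.1 hQ
    calc Q.adjugate = Q.adjugate * (Q * Qᵀ) := by rw [h2, mul_one]
      _ = -Qᵀ := by rw [← Matrix.mul_assoc, adjugate_mul, hdet]; simp
  rw [adjugate_fin_three] at h1
  have h3 := fun i => congrFun (congrFun h1 i) 2
  funext i
  have h4 := h3 i
  fin_cases i <;> simp [cross_apply] at h4 ⊢ <;> linarith

lemma posSemidef_of_det_eq_neg_one {Q : Matrix (Fin 3) (Fin 3) ℝ} (hQ : Qᵀ * Q = 1)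
    (hdet : Q.det = -1) : (1 + pauliTensor Q).PosSemidef := by
  have h2 : Q * Qᵀ = 1 := mul_eq_one_comm.1 hQ
  have hdot : ∀ i j, Q i ⬝ᵥ Q j = if i = j then 1 else 0 := fun i j => by
    have := congrFun (congrFun h2 i) j
    rwa [Matrix.one_apply] at this
  have h := posSemidef_one_add_pauliTensor (e₀ := ![1, 0, 0]) (e₁ := ![0, 1, 0])
    (t₀ := Q 0) (t₁ := Q 1) (by simp) (by simp [hdot]) (by simp [hdot]) (by simp [hdot])
  convert! h using 3
  have h3 := row_two_eq_of_det_eq_neg_one hQ hdet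
  ext i j
  have h4 := congrFun h3 j
  simp only [Matrix.sub_apply, Matrix.add_apply, vecMulVec_apply]
  fin_cases i <;> simp [cross_apply (![1, 0, 0] : Fin 3 → ℝ)]
  simpa using h4

lemma IsContr.transpose {T : Matrix (Fin 3) (Fin 3) ℝ} (hT : IsContr T) : IsContr Tᵀ := by
  intro v w hv hw
  rw [dotProduct_mulVec, vecMul_transpose, dotProduct_comm]
  exact hT w v hw hv

lemma IsContr.mulVec_le {T : Matrix (Fin 3) (Fin 3) ℝ} (hT : IsContr T) {w : Fin 3 → ℝ}
    (hw : w ⬝ᵥ w ≤ 1) : (T *ᵥ w) ⬝ᵥ (T *ᵥ w) ≤ 1 := by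
  have h0 : 0 ≤ (T *ᵥ w) ⬝ᵥ (T *ᵥ w) := by simpa using dotProduct_star_self_nonneg (T *ᵥ w)
  have h := hT.le_mul (v := T *ᵥ w) (w := w) (q := 1) (Real.sqrt_nonneg _) zero_le_one
    (Real.sq_sqrt h0).ge (by simpa using hw)
  have h2 := Real.sq_sqrt h0
  nlinarith [Real.sqrt_nonneg ((T *ᵥ w) ⬝ᵥ (T *ᵥ w))]

/-- One third of a contraction is the correlation tensor of a (separable) quantum state. -/
lemma posSemidef_third {T : Matrix (Fin 3) (Fin 3) ℝ} (hT : IsContr T) :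
    (1 + pauliTensor ((3 : ℝ)⁻¹ • T)).PosSemidef := by
  have hk : ∀ k : Fin 3, (1 + pauliTensor (vecMulVec (Pi.single k 1) (T k))).PosSemidef := by
    intro k
    rw [pauliTensor_vecMulVec]
    refine posSemidef_one_add (kronecker_isHermitian _ _) ?_ (kronecker_mul_self _ _)
    have h := hT.transpose.mulVec_le (w := Pi.single k 1) (by simp)
    have hrow : Tᵀ *ᵥ Pi.single k 1 = T k := by
      rw [mulVec_single_one]
      rfl
    rw [hrow] at h
    simpa using h
  have h := posSemidef_ofReal_smul (posSemidef_sum Finset.univ fun k _ => hk k)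
    (c := 3⁻¹) (by norm_num)
  convert! h using 1
  have hT' : T = vecMulVec (Pi.single 0 1) (T 0) + vecMulVec (Pi.single 1 1) (T 1) +
      vecMulVec (Pi.single 2 1) (T 2) := by
    ext i j
    fin_cases i <;> simp [vecMulVec_apply]
  conv_lhs => rw [hT']
  rw [pauliTensor_smul, pauliTensor_add, pauliTensor_add, Fin.sum_univ_three]
  push_cast
  module

/-- In the plane spanned by two orthonormal vectors there is an orthonormal pair whose images
under a given linear map are orthogonal. -/
lemma exists_rotation_orthogonal_image (T : Matrix (Fin 3) (Fin 3) ℝ) (e₀ e₁ : Fin 3 → ℝ) :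
    ∃ c s : ℝ, c ^ 2 + s ^ 2 = 1 ∧
      (T *ᵥ (c • e₀ + s • e₁)) ⬝ᵥ (T *ᵥ (-s • e₀ + c • e₁)) = 0 := by
  set f : ℝ → ℝ := fun θ => (T *ᵥ (Real.cos θ • e₀ + Real.sin θ • e₁)) ⬝ᵥ
    (T *ᵥ (-Real.sin θ • e₀ + Real.cos θ • e₁)) with hf
  have hexp : ∀ θ, f θ = (Real.cos θ ^ 2 - Real.sin θ ^ 2) * ((T *ᵥ e₀) ⬝ᵥ (T *ᵥ e₁)) +
      Real.cos θ * Real.sin θ *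
        ((T *ᵥ e₁) ⬝ᵥ (T *ᵥ e₁) - (T *ᵥ e₀) ⬝ᵥ (T *ᵥ e₀)) := fun θ => by
    simp only [hf, mulVec_add, mulVec_smul, add_dotProduct, dotProduct_add, smul_dotProduct,
      dotProduct_smul, smul_eq_mul, dotProduct_comm (T *ᵥ e₁) (T *ᵥ e₀)]
    ring
  have hcont : Continuous f := by
    rw [funext hexp]
    fun_prop
  have h0 : f 0 = (T *ᵥ e₀) ⬝ᵥ (T *ᵥ e₁) := by simp [hexp]
  have h1 : f (Real.pi / 2) = -((T *ᵥ e₀) ⬝ᵥ (T *ᵥ e₁)) := by simp [hexp]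
  have hmem : (0 : ℝ) ∈ Set.uIcc (f 0) (f (Real.pi / 2)) := by
    rw [h0, h1, Set.mem_uIcc]
    rcases le_total ((T *ᵥ e₀) ⬝ᵥ (T *ᵥ e₁)) 0 with h | h
    · exact Or.inl ⟨h, by linarith⟩
    · exact Or.inr ⟨by linarith, h⟩
  obtain ⟨θ, -, hθ⟩ := intermediate_value_uIcc hcont.continuousOn hmem
  exact ⟨Real.cos θ, Real.sin θ, Real.cos_sq_add_sin_sq θ, hθ⟩

/-- Vectors orthogonal to a fixed nonzero vector lie in the span of an orthonormal pair. -/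
lemma exists_orthonormal_pair {n : Fin 3 → ℝ} (hn : n ≠ 0) :
    ∃ e₀ e₁ : Fin 3 → ℝ, e₀ ⬝ᵥ e₀ = 1 ∧ e₁ ⬝ᵥ e₁ = 1 ∧ e₀ ⬝ᵥ e₁ = 0 ∧
      ∀ a, a ⬝ᵥ n = 0 → a = (a ⬝ᵥ e₀) • e₀ + (a ⬝ᵥ e₁) • e₁ := by
  set N : EuclideanSpace ℝ (Fin 3) := WithLp.toLp 2 n with hN
  have hN0 : N ≠ 0 := by simpa [hN] using hn
  have hnorm : ‖N‖ ≠ 0 := norm_ne_zero_iff.2 hN0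
  have hortho : Orthonormal ℝ (({2} : Set (Fin 3)).domRestrict
      fun _ : Fin 3 => (‖N‖⁻¹ : ℝ) • N) := by
    refine ⟨fun i => ?_, fun i j hij => absurd (Subsingleton.elim i j) hij⟩
    simp [norm_smul, hnorm]
  obtain ⟨b, hb⟩ := hortho.exists_orthonormalBasis_extension_of_card_eq (by simp)
  have hb2 : b 2 = ‖N‖⁻¹ • N := hb 2 rfl
  have hinner : ∀ x y : EuclideanSpace ℝ (Fin 3), inner ℝ x y = x.ofLp ⬝ᵥ y.ofLp := fun x y => by
    rw [EuclideanSpace.inner_eq_star_dotProduct, dotProduct_comm]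
    simp
  have hbb : ∀ i j, (b i).ofLp ⬝ᵥ (b j).ofLp = if i = j then 1 else 0 := fun i j => by
    rw [← hinner]
    exact orthonormal_iff_ite.1 b.orthonormal i j
  refine ⟨(b 0).ofLp, (b 1).ofLp, by simp [hbb], by simp [hbb], by simp [hbb], fun a ha => ?_⟩
  have h := b.sum_repr' (WithLp.toLp 2 a)
  have h2 : inner ℝ (b 2) (WithLp.toLp 2 a) = 0 := by
    rw [hinner, hb2, dotProduct_comm]
    simp [hN, ha]
  rw [Fin.sum_univ_three, h2, hinner, hinner] at h
  have h3 := congrArg WithLp.ofLp h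
  simp [dotProduct_comm _ a] at h3
  exact h3.symm

/-- If the rows of `A` all lie in a plane, any contraction agrees on them with a tensor of the form
appearing in `posSemidef_one_add_pauliTensor`. -/
lemma exists_vectors_of_plane {m : ℕ} {A : Matrix (Fin m) (Fin 3) ℝ} {n : Fin 3 → ℝ}
    (hn : n ≠ 0) (hA : A *ᵥ n = 0) {T : Matrix (Fin 3) (Fin 3) ℝ} (hT : IsContr T) :
    ∃ e₀ e₁ t₀ t₁ : Fin 3 → ℝ, e₀ ⬝ᵥ e₁ = 0 ∧ t₀ ⬝ᵥ t₁ = 0 ∧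
      (e₀ ⬝ᵥ e₀) * (t₀ ⬝ᵥ t₀) ≤ 1 ∧ (e₁ ⬝ᵥ e₁) * (t₁ ⬝ᵥ t₁) ≤ 1 ∧
      A * (vecMulVec e₀ t₀ + vecMulVec e₁ t₁ -
        vecMulVec (crossProduct e₀ e₁) (crossProduct t₀ t₁)) = A * T := by
  obtain ⟨f₀, f₁, h00, h11, h01, hspan⟩ := exists_orthonormal_pair hn
  obtain ⟨c, s, hcs, horth⟩ := exists_rotation_orthogonal_image Tᵀ f₀ f₁
  set e₀ := c • f₀ + s • f₁ with he₀
  set e₁ := -s • f₀ + c • f₁ with he₁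
  have h10 : f₁ ⬝ᵥ f₀ = 0 := by rw [dotProduct_comm, h01]
  have g00 : e₀ ⬝ᵥ e₀ = 1 := by
    simp [he₀, h00, h11, h01, h10]
    linarith
  have g11 : e₁ ⬝ᵥ e₁ = 1 := by
    simp [he₁, h00, h11, h01, h10]
    linarith
  have g01 : e₀ ⬝ᵥ e₁ = 0 := by
    simp [he₀, he₁, h00, h11, h01, h10]
    ring
  have gspan : ∀ i, A i = (A i ⬝ᵥ e₀) • e₀ + (A i ⬝ᵥ e₁) • e₁ := fun i => by
    have h := hspan (A i) (congrFun hA i)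
    conv_lhs => rw [h]
    simp only [he₀, he₁, dotProduct_add, dotProduct_smul, smul_eq_mul]
    ext k
    simp
    linear_combination -((A i ⬝ᵥ f₀) * f₀ k + (A i ⬝ᵥ f₁) * f₁ k) * hcs
  refine ⟨e₀, e₁, Tᵀ *ᵥ e₀, Tᵀ *ᵥ e₁, g01, horth, ?_, ?_, ?_⟩
  · rw [g00, one_mul]
    exact hT.transpose.mulVec_le g00.le
  · rw [g11, one_mul]
    exact hT.transpose.mulVec_le g11.le
  · have hcross : A *ᵥ crossProduct e₀ e₁ = 0 := by
      funext i
      change A i ⬝ᵥ crossProduct e₀ e₁ = 0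
      rw [gspan i, add_dotProduct, smul_dotProduct, smul_dotProduct, dot_self_cross,
        dot_cross_self]
      simp
    rw [Matrix.mul_sub, Matrix.mul_add, mul_vecMulVec, mul_vecMulVec, mul_vecMulVec, hcross, zero_vecMulVec,
      sub_zero]
    ext i j
    have h : (A * T) i j = (A i ᵥ* T) j := rfl
    rw [h, gspan i, add_vecMul, smul_vecMul, smul_vecMul, ← mulVec_transpose, ← mulVec_transpose]
    rfl

lemma mem_Cqm_of_rank_le_two {m : ℕ} {A B : Matrix (Fin m) (Fin 3) ℝ}
    (h : (∃ n, n ≠ 0 ∧ A *ᵥ n = 0) ∨ ∃ n, n ≠ 0 ∧ B *ᵥ n = 0)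
    {T : Matrix (Fin 3) (Fin 3) ℝ} (hT : IsContr T) : A * T * Bᵀ ∈ Cqm A B := by
  rcases h with ⟨n, hn, hA⟩ | ⟨n, hn, hB⟩
  · obtain ⟨e₀, e₁, t₀, t₁, he, ht, h₀, h₁, h⟩ := exists_vectors_of_plane hn hA hT
    rw [← h]
    exact mem_Cqm A B (posSemidef_one_add_pauliTensor he ht h₀ h₁)
  · obtain ⟨e₀, e₁, t₀, t₁, he, ht, h₀, h₁, h⟩ := exists_vectors_of_plane hn hB hT.transpose
    have h' := congrArg Matrix.transpose h
    simp only [transpose_mul, transpose_sub, transpose_add, transpose_vecMulVec,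
      transpose_transpose] at h'
    rw [Matrix.mul_assoc, ← h', ← Matrix.mul_assoc]
    exact mem_Cqm A B (posSemidef_one_add_pauliTensor ht he (by rwa [mul_comm])
      (by rwa [mul_comm]))

lemma finrank_ker_add_rank {m : ℕ} (A : Matrix (Fin m) (Fin 3) ℝ) :
    A.rank + Module.finrank ℝ (LinearMap.ker A.mulVecLin) = 3 := by
  have := A.mulVecLin.finrank_range_add_finrank_ker
  simpa [Matrix.rank] using this

lemma exists_mulVec_eq_zero_of_rank_le_two {m : ℕ} {A : Matrix (Fin m) (Fin 3) ℝ}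
    (h : A.rank ≤ 2) : ∃ n, n ≠ 0 ∧ A *ᵥ n = 0 := by
  have h1 := finrank_ker_add_rank A
  have h2 : LinearMap.ker A.mulVecLin ≠ ⊥ := fun h2 => by
    rw [h2, finrank_bot] at h1
    omega
  obtain ⟨n, hn, hn0⟩ := (Submodule.ne_bot_iff _).1 h2
  exact ⟨n, hn0, by simpa using hn⟩

lemma eq_zero_of_mulVec_eq_zero {m : ℕ} {A : Matrix (Fin m) (Fin 3) ℝ}
    (h : A.rank = 3) {v : Fin 3 → ℝ} (hv : A *ᵥ v = 0) : v = 0 := by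
  have h1 := finrank_ker_add_rank A
  have h2 : LinearMap.ker A.mulVecLin = ⊥ := Submodule.finrank_eq_zero.1 (by omega)
  have h3 : v ∈ LinearMap.ker A.mulVecLin := by simpa using hv
  simpa [h2] using h3

lemma eq_zero_of_mul_eq_zero {m p : ℕ} {A : Matrix (Fin m) (Fin 3) ℝ} (h : A.rank = 3)
    {M : Matrix (Fin 3) (Fin p) ℝ} (hM : A * M = 0) : M = 0 := by
  ext i j
  have h1 : A *ᵥ (fun k => M k j) = 0 := by
    funext i
    exact congrFun (congrFun hM i) j
  exact congrFun (eq_zero_of_mulVec_eq_zero h h1) i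

lemma eq_of_mul_mul_transpose_eq {m : ℕ} {A B : Matrix (Fin m) (Fin 3) ℝ} (hA : A.rank = 3)
    (hB : B.rank = 3) {S T : Matrix (Fin 3) (Fin 3) ℝ} (h : A * S * Bᵀ = A * T * Bᵀ) :
    S = T := by
  rw [← sub_eq_zero, ← Matrix.sub_mul, ← Matrix.mul_sub, Matrix.mul_assoc] at h
  have h1 := congrArg Matrix.transpose (eq_zero_of_mul_eq_zero hA h)
  rw [transpose_mul, transpose_transpose, transpose_zero] at h1
  have h2 := congrArg Matrix.transpose (eq_zero_of_mul_eq_zero hB h1)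
  rw [transpose_transpose, transpose_zero] at h2
  exact sub_eq_zero.1 h2

lemma gaugeFn_le {m : ℕ} {K : Set (Matrix (Fin m) (Fin m) ℝ)} {C : Matrix (Fin m) (Fin m) ℝ}
    {t : ℝ} (ht : 0 < t) (h : t⁻¹ • C ∈ K) : gaugeFn K C ≤ ENNReal.ofReal t :=
  iInf₂_le t ⟨ht, h⟩

lemma gaugeFn_le_one {m : ℕ} {K : Set (Matrix (Fin m) (Fin m) ℝ)}
    {C : Matrix (Fin m) (Fin m) ℝ} (h : C ∈ K) : gaugeFn K C ≤ 1 := by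
  simpa using gaugeFn_le (K := K) (C := C) one_pos (by simpa using h)

lemma le_gaugeFn_Cqm {m : ℕ} {A B : Matrix (Fin m) (Fin 3) ℝ} {T : Matrix (Fin 3) (Fin 3) ℝ}
    {c : ℝ} (h : ∀ t : ℝ, 0 < t → ∀ ρ ∈ Sqm, A * corrTensor ρ * Bᵀ = A * (t⁻¹ • T) * Bᵀ → c ≤ t) :
    ENNReal.ofReal c ≤ gaugeFn (Cqm A B) (A * T * Bᵀ) := by
  refine le_iInf₂ fun t ⟨ht, ρ, hρ, hC⟩ => ENNReal.ofReal_le_ofReal (h t ht ρ hρ ?_)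
  rw [← corr_eq, hC, Matrix.mul_smul, Matrix.smul_mul]

lemma one_le_gaugeFn {m : ℕ} {A B : Matrix (Fin m) (Fin 3) ℝ} {Q : Matrix (Fin 3) (Fin 3) ℝ}
    (hQ : Qᵀ * Q = 1)
    (hne : colSpace Aᵀ ⊓ Submodule.map Q.mulVecLin (colSpace Bᵀ) ≠ ⊥) :
    1 ≤ gaugeFn (Cqm A B) (A * Q * Bᵀ) := by
  obtain ⟨v, ⟨⟨a, ha⟩, w, ⟨b, hb⟩, hw⟩, hv0⟩ := (Submodule.ne_bot_iff _).1 hne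
  simp only [mulVecLin_apply] at ha hb hw
  rw [← ENNReal.ofReal_one]
  refine le_gaugeFn_Cqm fun t ht ρ hρ h => ?_
  have hww : w ⬝ᵥ w = v ⬝ᵥ v := by
    rw [← hw, dotProduct_mulVec, ← mulVec_transpose, mulVec_mulVec, hQ, one_mulVec]
  have hpos : 0 < v ⬝ᵥ v := by
    simpa using dotProduct_star_self_pos_iff.2 hv0
  have key : ∀ S : Matrix (Fin 3) (Fin 3) ℝ, v ⬝ᵥ S *ᵥ w = a ⬝ᵥ (A * S * Bᵀ) *ᵥ b := fun S => by
    rw [← ha, ← hb, mulVec_transpose, ← dotProduct_mulVec, mulVec_mulVec, mulVec_mulVec]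
  have h1 : v ⬝ᵥ corrTensor ρ *ᵥ w = t⁻¹ * (v ⬝ᵥ v) := by
    rw [key, h, ← key, smul_mulVec, dotProduct_smul, hw, smul_eq_mul]
  have h2 := (isContr_corrTensor (Sqm_subset_Smax hρ)).le_mul (v := v) (w := w)
    (Real.sqrt_nonneg (v ⬝ᵥ v)) (Real.sqrt_nonneg (v ⬝ᵥ v)) (Real.sq_sqrt hpos.le).ge
    (by rw [hww, Real.sq_sqrt hpos.le])
  rw [Real.mul_self_sqrt hpos.le, h1] at h2
  have h3 : t⁻¹ ≤ 1 := by
    by_contra! h3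
    nlinarith
  exact (inv_le_one₀ ht).1 h3

lemma inf_ne_bot_of_two_le_rank {m : ℕ} {A B : Matrix (Fin m) (Fin 3) ℝ} (hA : 2 ≤ A.rank)
    (hB : 2 ≤ B.rank) {Q : Matrix (Fin 3) (Fin 3) ℝ} (hQ : Qᵀ * Q = 1) :
    colSpace Aᵀ ⊓ Submodule.map Q.mulVecLin (colSpace Bᵀ) ≠ ⊥ := by
  intro h
  have hinj : Function.Injective Q.mulVecLin := fun x y hxy => by
    have h1 := congrArg (Qᵀ *ᵥ ·) hxy
    simpa [hQ] using h1
  have h1 : Module.finrank ℝ (colSpace Aᵀ) = A.rank := rank_transpose A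
  have h2 : Module.finrank ℝ (colSpace Bᵀ) = B.rank := rank_transpose B
  have h3 := (Submodule.equivMapOfInjective Q.mulVecLin hinj (colSpace Bᵀ)).finrank_eq
  have h4 := Submodule.finrank_add_finrank_le_of_disjoint (disjoint_iff.2 h)
  rw [← h3, h1, h2] at h4
  simp at h4
  omega

lemma three_le_gaugeFn {m : ℕ} {A B : Matrix (Fin m) (Fin 3) ℝ} (hA : A.rank = 3)
    (hB : B.rank = 3) {Q : Matrix (Fin 3) (Fin 3) ℝ} (hQ : Qᵀ * Q = 1) (hdet : Q.det = 1) :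
    3 ≤ gaugeFn (Cqm A B) (A * Q * Bᵀ) := by
  rw [← ENNReal.ofReal_ofNat 3]
  refine le_gaugeFn_Cqm fun t ht ρ hρ h => ?_
  have hT := eq_of_mul_mul_transpose_eq hA hB h
  have hpsd := posSemidef_of_det_eq_neg_one (Q := -Q) (by simpa using hQ)
    (by rw [det_neg, hdet]; norm_num)
  have h1 := re_trace_mul_nonneg hρ.1 hpsd
  rw [mul_add, mul_one, trace_add, hρ.2, Complex.add_re, re_trace_mul_pauliTensor, hT] at h1
  have h2 : ∑ k, ∑ l, Q k l * Q k l = 3 := by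
    have h3 := congrArg trace hQ
    rw [trace_one] at h3
    rw [Finset.sum_comm]
    simpa [trace, Matrix.mul_apply] using h3
  have h4 : ∑ k, ∑ l, (-Q) k l * (t⁻¹ • Q) k l = -(t⁻¹ * 3) := by
    rw [← h2, Finset.mul_sum, ← Finset.sum_neg_distrib]
    refine Finset.sum_congr rfl fun k _ => ?_
    rw [Finset.mul_sum, ← Finset.sum_neg_distrib]
    refine Finset.sum_congr rfl fun l _ => ?_
    simp only [Matrix.neg_apply, Matrix.smul_apply, smul_eq_mul]
    ring
  rw [h4, Complex.one_re] at h1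
  have h5 : t⁻¹ * 3 ≤ 1 := by linarith
  rwa [inv_mul_le_one₀ ht] at h5

lemma gaugeFn_le_one_of_mem_Cmax {m : ℕ} {A B : Matrix (Fin m) (Fin 3) ℝ}
    (h : A.rank ≤ 2 ∨ B.rank ≤ 2) {C : Matrix (Fin m) (Fin m) ℝ} (hC : C ∈ Cmax A B) :
    gaugeFn (Cqm A B) C ≤ 1 := by
  obtain ⟨ρ, hρ, rfl⟩ := hC
  rw [corr_eq]
  exact gaugeFn_le_one (mem_Cqm_of_rank_le_two
    (h.imp exists_mulVec_eq_zero_of_rank_le_two exists_mulVec_eq_zero_of_rank_le_two)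
    (isContr_corrTensor hρ))

lemma gaugeFn_le_three_of_mem_Cmax {m : ℕ} {A B : Matrix (Fin m) (Fin 3) ℝ}
    {C : Matrix (Fin m) (Fin m) ℝ} (hC : C ∈ Cmax A B) : gaugeFn (Cqm A B) C ≤ 3 := by
  obtain ⟨ρ, hρ, rfl⟩ := hC
  rw [← ENNReal.ofReal_ofNat 3]
  refine gaugeFn_le (by norm_num) ?_
  rw [corr_eq, ← Matrix.smul_mul, ← Matrix.mul_smul]
  exact mem_Cqm A B (posSemidef_third (isContr_corrTensor hρ))

/-- Maximizers of `γ_{C_qm}` over `C_max`. -/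
theorem stmt16 {m : ℕ} (hm : 1 ≤ m) (A B : Matrix (Fin m) (Fin 3) ℝ)
    (hA : ∀ i, ∑ k, A i k ^ 2 = 1) (hB : ∀ i, ∑ k, B i k ^ 2 = 1) :
    (min A.rank B.rank = 3 →
      (∀ C ∈ Cmax A B, gaugeFn (Cqm A B) C ≤ 3) ∧
      (∀ Q : Matrix (Fin 3) (Fin 3) ℝ, Qᵀ * Q = 1 → Q.det = 1 →
        A * Q * Bᵀ ∈ Cmax A B ∧ gaugeFn (Cqm A B) (A * Q * Bᵀ) = 3) ∧
      (∀ Q : Matrix (Fin 3) (Fin 3) ℝ, Qᵀ * Q = 1 → Q.det = -1 →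
        gaugeFn (Cqm A B) (A * Q * Bᵀ) = 1)) ∧
    (min A.rank B.rank ≤ 2 → 2 ≤ A.rank → 2 ≤ B.rank →
      (∀ C ∈ Cmax A B, gaugeFn (Cqm A B) C ≤ 1) ∧
      (∀ Q : Matrix (Fin 3) (Fin 3) ℝ, Qᵀ * Q = 1 →
        A * Q * Bᵀ ∈ Cmax A B ∧ gaugeFn (Cqm A B) (A * Q * Bᵀ) = 1)) ∧
    (A.rank = 1 ∨ B.rank = 1 →
      (∀ C ∈ Cmax A B, gaugeFn (Cqm A B) C ≤ 1) ∧
      (∀ Q : Matrix (Fin 3) (Fin 3) ℝ, Qᵀ * Q = 1 →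
        colSpace Aᵀ ⊓ Submodule.map Q.mulVecLin (colSpace Bᵀ) ≠ ⊥ →
        A * Q * Bᵀ ∈ Cmax A B ∧ gaugeFn (Cqm A B) (A * Q * Bᵀ) = 1)) := by

  have hAle := A.rank_le_width
  have hBle := B.rank_le_width
  refine ⟨fun hr => ?_, fun hr h2A h2B => ?_, fun hr => ?_⟩
  · have h3A : A.rank = 3 := by omega
    have h3B : B.rank = 3 := by omega
    refine ⟨fun C hC => gaugeFn_le_three_of_mem_Cmax hC, fun Q hQ hdet => ?_, fun Q hQ hdet => ?_⟩
    · have hC := mem_Cmax A B (isContr_of_orthogonal hQ)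
      exact ⟨hC, le_antisymm (gaugeFn_le_three_of_mem_Cmax hC) (three_le_gaugeFn h3A h3B hQ hdet)⟩
    · exact le_antisymm (gaugeFn_le_one (mem_Cqm A B (posSemidef_of_det_eq_neg_one hQ hdet)))
        (one_le_gaugeFn hQ (inf_ne_bot_of_two_le_rank (by omega) (by omega) hQ))
  · have h2 : A.rank ≤ 2 ∨ B.rank ≤ 2 := by omega
    refine ⟨fun C hC => gaugeFn_le_one_of_mem_Cmax h2 hC, fun Q hQ => ?_⟩
    have hC := mem_Cmax A B (isContr_of_orthogonal hQ)
    exact ⟨hC, le_antisymm (gaugeFn_le_one_of_mem_Cmax h2 hC)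
      (one_le_gaugeFn hQ (inf_ne_bot_of_two_le_rank h2A h2B hQ))⟩
  · have h2 : A.rank ≤ 2 ∨ B.rank ≤ 2 := by omega
    refine ⟨fun C hC => gaugeFn_le_one_of_mem_Cmax h2 hC, fun Q hQ hne => ?_⟩
    have hC := mem_Cmax A B (isContr_of_orthogonal hQ)
    exact ⟨hC, le_antisymm (gaugeFn_le_one_of_mem_Cmax h2 hC) (one_le_gaugeFn hQ hne)⟩

end BellCorr
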